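/- arXiv:2207.00051 — 2 statements merged into one kernel-verified Lean document; each statement's English description precedes it below -/
import Mathlib

section
/- If S is a reflective numerical semigroup with genus g(S) = g ≥ 1 and multiplicity m(S) = a, and r is the unique integer in {1, ..., a−1} with g ≡ r (mod a), then the Frobenius number of S is F(S) = 2g − r. -/
/-- A numerical semigroup: a subset of ℕ containing 0, closed under addition,
with finite complement. -/
def IsNumericalSemigroup (S : Set ℕ) : Prop :=
  0 ∈ S ∧ (∀ a ∈ S, ∀ b ∈ S, a + b ∈ S) ∧ Sᶜ.Finite

/-- The genus: number of gaps. -/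
noncomputable def genus (S : Set ℕ) : ℕ := Sᶜ.ncard

/-- The Frobenius number: the largest gap. -/
noncomputable def frob (S : Set ℕ) : ℕ := sSup Sᶜ

/-- The multiplicity: the smallest positive element. -/
noncomputable def mult (S : Set ℕ) : ℕ := sInf {n ∈ S | 0 < n}

/-- A numerical semigroup is reflective if for each z ∈ {0,...,g-1}
exactly one of z and z + g lies in S, where g is the genus. -/
def Reflective (S : Set ℕ) : Prop :=
  ∀ z < genus S, Xor' (z ∈ S) (z + genus S ∈ S)

/-- A set A is equidistributed modulo m if each residue class mod m contains
the same number of elements of A. -/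
def Equidistributed (A : Set ℕ) (m : ℕ) : Prop :=
  ∀ r₁ < m, ∀ r₂ < m, {x ∈ A | x % m = r₁}.ncard = {x ∈ A | x % m = r₂}.ncard

/-- The submonoid of ℕ generated by A. -/
def gen (A : Set ℕ) : Set ℕ := (AddSubmonoid.closure A : Set ℕ)

/-- The (unique) minimal generating set of a numerical semigroup: nonzero elements
not expressible as a sum of two nonzero elements. -/
def minGens (S : Set ℕ) : Set ℕ :=
  {n ∈ S | n ≠ 0 ∧ ∀ a ∈ S, ∀ b ∈ S, a ≠ 0 → b ≠ 0 → n ≠ a + b}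

/-- The embedding dimension: the cardinality of the minimal generating set. -/
noncomputable def embdim (S : Set ℕ) : ℕ := (minGens S).ncard

/-- The Apéry set of S relative to t: elements s of S with s - t ∉ S. -/
def aperySet (S : Set ℕ) (t : ℕ) : Set ℕ := {s ∈ S | ∀ u ∈ S, s ≠ u + t}

/-- Pseudo-Frobenius numbers: gaps h such that h + s ∈ S for every nonzero s ∈ S. -/
def pseudoFrobenius (S : Set ℕ) : Set ℕ :=
  {h | h ∉ S ∧ ∀ s ∈ S, s ≠ 0 → h + s ∈ S}

/-- Membership of an integer in (the image in ℤ of) a numerical semigroup. -/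
def memZ (S : Set ℕ) (z : ℤ) : Prop := 0 ≤ z ∧ z.toNat ∈ S

/-- Symmetric numerical semigroup. -/
def IsSymmetricNS (S : Set ℕ) : Prop :=
  ∀ z : ℤ, Xor' (memZ S z) (memZ S ((frob S : ℤ) - z))

/-- Pseudo-symmetric numerical semigroup. -/
def IsPseudoSymmetricNS (S : Set ℕ) : Prop :=
  2 ∣ frob S ∧ ∀ z : ℤ, z ≠ (frob S : ℤ) / 2 →
    Xor' (memZ S z) (memZ S ((frob S : ℤ) - z))

/-- Irreducible numerical semigroup. -/
def IsIrreducibleNS (S : Set ℕ) : Prop :=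
  ¬ ∃ T₁ T₂ : Set ℕ, IsNumericalSemigroup T₁ ∧ IsNumericalSemigroup T₂ ∧
    S ⊂ T₁ ∧ S ⊂ T₂ ∧ S = T₁ ∩ T₂

/-- A telescopic sequence a₁,...,a_k (1-indexed) of positive integers. -/
def TelescopicSeq (a : ℕ → ℕ) (k : ℕ) : Prop :=
  (∀ i ∈ Finset.Icc 1 k, 0 < a i) ∧
  ∀ j ∈ Finset.Icc 2 k,
    ((Finset.Icc 1 (j-1)).gcd a / (Finset.Icc 1 j).gcd a) * a j ∈
      gen (a '' Set.Icc 1 (j-1))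

/-- A free numerical semigroup: one generated by (the underlying set of)
a telescopic sequence. -/
def IsFreeNS (S : Set ℕ) : Prop :=
  ∃ (k : ℕ) (a : ℕ → ℕ), TelescopicSeq a k ∧ S = gen (a '' Set.Icc 1 k)

/-- Every gap of a reflective numerical semigroup is smaller than twice the genus. -/
theorem Reflective.lt_two_mul_genus {S : Set ℕ} (hfin : Sᶜ.Finite) (hrefl : Reflective S)
    {x : ℕ} (hx : x ∉ S) : x < 2 * genus S := by
  classical
  set f : ℕ → ℕ := fun z => if z ∈ S then z + genus S else z with hf
  have hsub : (Finset.range (genus S)).image f ⊆ hfin.toFinset := by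
    intro y hy
    obtain ⟨z, hz, rfl⟩ := Finset.mem_image.mp hy
    have := hrefl z (Finset.mem_range.mp hz)
    simp only [Set.Finite.mem_toFinset, Set.mem_compl_iff, hf]
    split_ifs with h
    · rcases this with h' | h'
      · exact h'.2
      · exact absurd h h'.2
    · exact h
  have hinj : Set.InjOn f (Finset.range (genus S)) := by
    intro y hy z hz hyz
    simp only [Finset.coe_range, Set.mem_Iio] at hy hz
    simp only [hf] at hyz
    split_ifs at hyz <;> omega
  have hcard : hfin.toFinset.card ≤ ((Finset.range (genus S)).image f).card := by
    rw [Finset.card_image_of_injOn hinj, Finset.card_range, genus,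
      Set.ncard_eq_toFinset_card _ hfin]
  have hmem : x ∈ (Finset.range (genus S)).image f := by
    rw [Finset.eq_of_subset_of_card_le hsub hcard]
    simpa using hx
  obtain ⟨z, hz, rfl⟩ := Finset.mem_image.mp hmem
  have := Finset.mem_range.mp hz
  simp only [hf]
  split_ifs <;> omega

theorem IsNumericalSemigroup.mul_mem {S : Set ℕ} (hS : IsNumericalSemigroup S) {a : ℕ}
    (ha : a ∈ S) (k : ℕ) : a * k ∈ S := by
  induction k with
  | zero => exact hS.1
  | succ k ih => exact hS.2.1 _ ih _ ha

theorem notMem_of_lt_mult {S : Set ℕ} {t : ℕ} (ht : 0 < t) (hlt : t < mult S) : t ∉ S :=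
  fun h => Nat.notMem_of_lt_sInf hlt ⟨h, ht⟩

theorem mult_mem {S : Set ℕ} (h : 0 < mult S) : mult S ∈ S :=
  (Nat.sInf_mem (Nat.nonempty_of_pos_sInf h)).1

theorem stmt5 (S : Set ℕ) (hS : IsNumericalSemigroup S) (hrefl : Reflective S)
    (g a r : ℕ) (hg : genus S = g) (hg1 : 1 ≤ g) (ha : mult S = a)
    (hr1 : 1 ≤ r) (hr2 : r ≤ a - 1) (hmod : g % a = r) :
    frob S = 2 * g - r := by
  subst hg ha
  have hdiv := Nat.div_add_mod (genus S) (mult S)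
  have hmul := hS.mul_mem (mult_mem (S := S) (by omega)) (genus S / mult S)
  set b := mult S * (genus S / mult S)
  have hgap : 2 * genus S - r ∉ S := by
    rcases hrefl b (by omega) with h | h
    · rw [show 2 * genus S - r = b + genus S by omega]
      exact h.2
    · exact absurd hmul h.2
  refine IsGreatest.csSup_eq ⟨hgap, fun x hx => ?_⟩
  by_contra! hlt
  have hx2 := hrefl.lt_two_mul_genus hS.2.2 hx
  obtain ⟨t, rfl⟩ : ∃ t, x = b + (t + genus S) :=
    ⟨x - genus S - b, by omega⟩
  rcases hrefl t (by omega) with h | h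
  · exact notMem_of_lt_mult (by omega) (by omega) h.1
  · exact hx (hS.2.1 _ hmul _ h.1)
end

section
/- Let S be a reflective numerical semigroup with genus g(S) = g ≥ 1 and multiplicity m(S) = a. Then the embedding dimension of S is e(S) = a − 1 if g ≢ −1 (mod a), and e(S) = a if g ≡ −1 (mod a). -/
/-- Every gap of a reflective numerical semigroup of genus `g` is smaller than `2 * g`. -/
lemma Reflective.mem_of_two_mul_genus_le {S : Set ℕ} (hS : IsNumericalSemigroup S)
    (hrefl : Reflective S) {n : ℕ} (hn : 2 * genus S ≤ n) : n ∈ S := by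
  classical
  by_contra hnS
  let f : ℕ → ℕ := fun z => if z ∈ S then z + genus S else z
  have hf : ∀ z < genus S, f z ∉ S ∧ f z % genus S = z ∧ f z < 2 * genus S := by
    intro z hz
    by_cases h : z ∈ S
    · rcases hrefl z hz with h' | h'
      · simp [f, h, h'.2, Nat.mod_eq_of_lt hz]
        omega
      · exact absurd h h'.2
    · simp [f, h, Nat.mod_eq_of_lt hz]
      omega
  have hinj : Set.InjOn f (Finset.range (genus S)) := by
    intro x hx y hy hxy
    rw [← (hf x (by simpa using hx)).2.1, ← (hf y (by simpa using hy)).2.1, hxy]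
  have hn' : n ∉ (Finset.range (genus S)).image f := by
    intro h
    obtain ⟨z, hz, rfl⟩ := Finset.mem_image.1 h
    have := (hf z (by simpa using hz)).2.2
    omega
  have hsub : (↑(insert n ((Finset.range (genus S)).image f)) : Set ℕ) ⊆ Sᶜ := by
    intro x hx
    rcases Finset.mem_insert.1 (Finset.mem_coe.1 hx) with rfl | h
    · exact hnS
    · obtain ⟨z, hz, rfl⟩ := Finset.mem_image.1 h
      exact (hf z (by simpa using hz)).1
  have hcard := Set.ncard_le_ncard hsub hS.2.2
  rw [Set.ncard_coe_finset, Finset.card_insert_of_notMem hn', Finset.card_image_of_injOn hinj,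
    Finset.card_range] at hcard
  exact absurd hcard (Nat.not_succ_le_self _)

/-- The multiplicity is a positive element, and no positive element is smaller. -/
lemma IsNumericalSemigroup.mult_spec {S : Set ℕ} (hS : IsNumericalSemigroup S) :
    mult S ∈ S ∧ 0 < mult S ∧ ∀ n ∈ S, 0 < n → mult S ≤ n := by
  have hne : {n ∈ S | 0 < n}.Nonempty := by
    obtain ⟨n, hn⟩ := (hS.2.2.union (Set.finite_singleton 0)).exists_notMem
    simp only [Set.mem_union, Set.mem_compl_iff, Set.mem_singleton_iff, not_or, not_not] at hn
    exact ⟨n, hn.1, Nat.pos_of_ne_zero hn.2⟩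
  have h : mult S ∈ {n ∈ S | 0 < n} := Nat.sInf_mem hne
  exact ⟨h.1, h.2, fun n hn h0 => Nat.sInf_le ⟨hn, h0⟩⟩

lemma IsNumericalSemigroup.add_mul_mem {S : Set ℕ} (hS : IsNumericalSemigroup S) {x a : ℕ}
    (hx : x ∈ S) (ha : a ∈ S) (k : ℕ) : x + a * k ∈ S := by
  induction k with
  | zero => simpa using hx
  | succ k ih => simpa [mul_add, add_assoc] using hS.2.1 _ ih _ ha

lemma Reflective.genus_notMem {S : Set ℕ} (hS : IsNumericalSemigroup S)
    (hrefl : Reflective S) (hg : 1 ≤ genus S) : genus S ∉ S := by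
  rcases hrefl 0 hg with h | h
  · simpa using h.2
  · exact absurd hS.1 h.2

lemma Reflective.not_mult_dvd_genus {S : Set ℕ} (hS : IsNumericalSemigroup S)
    (hrefl : Reflective S) (hg : 1 ≤ genus S) : ¬ mult S ∣ genus S := by
  rintro ⟨k, hk⟩
  apply hrefl.genus_notMem hS hg
  rw [hk]
  simpa using hS.add_mul_mem hS.1 hS.mult_spec.1 k

lemma Reflective.mult_le_genus_add_one {S : Set ℕ} (hS : IsNumericalSemigroup S)
    (hrefl : Reflective S) (hg : 1 ≤ genus S) : mult S ≤ genus S + 1 := by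
  obtain ⟨-, -, hmin⟩ := hS.mult_spec
  rcases hg.eq_or_lt with h | h
  · exact (hmin 2 (hrefl.mem_of_two_mul_genus_le hS (by omega)) (by omega)).trans (by omega)
  · rcases hrefl 1 h with h' | h'
    · exact (hmin 1 h'.1 one_pos).trans (by omega)
    · exact (hmin _ h'.1 (by omega)).trans (by omega)

/-- A reflective numerical semigroup is determined by its genus and multiplicity. -/
lemma Reflective.mem_iff {S : Set ℕ} (hS : IsNumericalSemigroup S)
    (hrefl : Reflective S) (hg : 1 ≤ genus S) (n : ℕ) :
    n ∈ S ↔ mult S ∣ n ∨ (genus S < n ∧ ¬ mult S ∣ n - genus S) ∨ 2 * genus S ≤ n := by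
  obtain ⟨haS, ha0, hmin⟩ := hS.mult_spec
  have hlarge : ∀ n, genus S < n → ¬ mult S ∣ n - genus S → n ∈ S := by
    intro n hn hd
    have hr : (n - genus S) % mult S ≠ 0 := fun h => hd (Nat.dvd_of_mod_eq_zero h)
    have hlt := Nat.mod_lt (n - genus S) ha0
    have hdiv := Nat.mod_add_div (n - genus S) (mult S)
    have hbase : (n - genus S) % mult S + genus S ∈ S := by
      rcases lt_or_ge ((n - genus S) % mult S) (genus S) with h | h
      · rcases hrefl _ h with h' | h'
        · exact absurd (hmin _ h'.1 (Nat.pos_of_ne_zero hr)) (by omega)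
        · exact h'.1
      · exact hrefl.mem_of_two_mul_genus_le hS (by omega)
    have h := hS.add_mul_mem hbase haS ((n - genus S) / mult S)
    rwa [show (n - genus S) % mult S + genus S + mult S * ((n - genus S) / mult S) = n by
      omega] at h
  have hmul : ∀ n, mult S ∣ n → n ∈ S := by
    rintro n ⟨k, rfl⟩
    simpa using hS.add_mul_mem hS.1 haS k
  constructor
  · intro hn
    by_contra! hcon
    obtain ⟨h1, h2, h3⟩ := hcon
    rcases lt_trichotomy n (genus S) with h | h | h
    · have hn' : n + genus S ∈ S := by
        refine hlarge _ ?_ (by simpa using h1)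
        have : n ≠ 0 := fun h0 => h1 (by simp [h0])
        omega
      rcases hrefl n h with h' | h'
      · exact h'.2 hn'
      · exact h'.2 hn
    · exact hrefl.genus_notMem hS hg (h ▸ hn)
    · rcases hrefl (n - genus S) (by omega) with h' | h'
      · exact h'.2 (by rwa [Nat.sub_add_cancel h.le])
      · exact h'.2 (hmul _ (h2 h))
  · rintro (h | ⟨h, h'⟩ | h)
    · exact hmul n h
    · exact hlarge n h h'
    · exact hrefl.mem_of_two_mul_genus_le hS h

/-- The minimal generators of a reflective numerical semigroup. -/
lemma Reflective.mem_minGens_iff {S : Set ℕ} (hS : IsNumericalSemigroup S)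
    (hrefl : Reflective S) (hg : 1 ≤ genus S) (n : ℕ) :
    n ∈ minGens S ↔ n = mult S ∨ (genus S < n ∧ n < genus S + mult S ∧ ¬ mult S ∣ n) ∨
      (n = 2 * genus S + 1 ∧ mult S ∣ genus S + 1) := by
  have hmem := hrefl.mem_iff hS hg
  have hdg := hrefl.not_mult_dvd_genus hS hg
  have hle := hrefl.mult_le_genus_add_one hS hg
  obtain ⟨haS, ha0, hmin⟩ := hS.mult_spec
  generalize genus S = g at *
  generalize mult S = a at *
  have ha1 : a ≠ 1 := fun h => hdg (h ▸ one_dvd g)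
  have hag : a ≠ g := fun h => hdg (h ▸ dvd_rfl)
  have hsmall : ∀ i, 0 < i → i < a → ¬ a ∣ i := fun i h0 hi h => by
    have := Nat.le_of_dvd h0 h
    omega
  have hshort : ∀ i, 0 < i → i < a → g + i ∈ S := fun i h0 hi =>
    (hmem _).2 (Or.inr (Or.inl ⟨by omega, by simpa using hsmall i h0 hi⟩))
  have hS' : ∀ x ∈ S, x ≠ 0 → a ∣ x ∨ g < x := by
    intro x hx hx0
    rcases (hmem x).1 hx with h | ⟨h, -⟩ | h
    · exact Or.inl h
    · exact Or.inr h
    · right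
      omega
  constructor
  · rintro ⟨hn, hn0, hirr⟩
    by_cases hna : n = a
    · exact Or.inl hna
    have han : a ≤ n := hmin n hn (by omega)
    have hsub : n - a ∉ S := fun h => hirr a haS (n - a) h (by omega) (by omega) (by omega)
    have hdn : ¬ a ∣ n := fun h => hsub ((hmem _).2 (Or.inl (Nat.dvd_sub h dvd_rfl)))
    have hgn : g < n := (hS' n hn hn0).resolve_left hdn
    right
    by_cases hlt : n < g + a
    · exact Or.inl ⟨hgn, hlt, hdn⟩
    right
    have hn2 : n - a < 2 * g := by
      by_contra h
      exact hsub ((hmem _).2 (Or.inr (Or.inr (by omega))))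
    have hdvd : a ∣ n - g := by
      by_cases h : n - a = g
      · exact ⟨1, by omega⟩
      · by_contra hd
        refine hsub ((hmem _).2 (Or.inr (Or.inl ⟨by omega, fun h' => hd ?_⟩)))
        have := Nat.dvd_add h' (dvd_refl a)
        rwa [show n - a - g + a = n - g by omega] at this
    have h2n : 2 * g ≤ n := by
      rcases (hmem n).1 hn with h | ⟨-, h⟩ | h
      · exact absurd h hdn
      · exact absurd hdvd h
      · exact h
    have hne : n ≠ 2 * g := by
      rintro rfl
      exact hdg (by rwa [show 2 * g - g = g by omega] at hdvd)
    have hn1 : n = 2 * g + 1 := by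
      by_contra h
      exact hirr (g + 1) (hshort 1 (by omega) (by omega)) (g + (n - 2 * g - 1))
        (hshort _ (by omega) (by omega)) (by omega) (by omega) (by omega)
    refine ⟨hn1, ?_⟩
    rwa [show n - g = g + 1 by omega] at hdvd
  · rintro (rfl | ⟨h1, h2, h3⟩ | ⟨rfl, hd⟩)
    · refine ⟨haS, ha0.ne', fun x hx y hy hx0 hy0 h => ?_⟩
      have := hmin x hx (by omega)
      omega
    · refine ⟨?_, by omega, fun x hx y hy hx0 hy0 h => ?_⟩
      · have := hshort (n - g) (by omega) (by omega)
        rwa [show g + (n - g) = n by omega] at this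
      · have hx1 := hmin x hx (by omega)
        have hy1 := hmin y hy (by omega)
        rcases hS' x hx hx0 with hx2 | hx2
        · rcases hS' y hy hy0 with hy2 | hy2
          · exact h3 (h ▸ dvd_add hx2 hy2)
          · omega
        · omega
    · have key : ∀ x ∈ S, ∀ y ∈ S, x ≠ 0 → y ≠ 0 → a ∣ x → 2 * g + 1 ≠ x + y := by
        intro x hx y hy hx0 hy0 hdx h
        have hx1 := hmin x hx (by omega)
        have hdy : ¬ a ∣ y := fun hdy => by
          have h' : a ∣ g + (g + 1) := by
            rw [show g + (g + 1) = x + y by omega]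
            exact dvd_add hdx hdy
          exact hdg ((Nat.dvd_add_left hd).1 h')
        rcases (hmem y).1 hy with hy1 | ⟨hy1, hy2⟩ | hy1
        · exact hdy hy1
        · apply hy2
          rw [show y - g = g + 1 - x by omega]
          exact Nat.dvd_sub hd hdx
        · omega
      refine ⟨(hmem _).2 (by omega), by omega, fun x hx y hy hx0 hy0 h => ?_⟩
      rcases hS' x hx hx0 with hx2 | hx2
      · exact key x hx y hy hx0 hy0 hx2 h
      · rcases hS' y hy hy0 with hy2 | hy2
        · exact key y hy x hx hy0 hx0 hy2 (by omega)
        · omega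

/-- If `a ∤ g`, exactly one of the `a - 1` integers strictly between `g` and `g + a` is a
multiple of `a`. -/
lemma card_filter_not_dvd_Ioo {a g : ℕ} (ha : 0 < a) (hd : ¬ a ∣ g) :
    {n ∈ Finset.Ioo g (g + a) | ¬ a ∣ n}.card = a - 2 := by
  have hr : g % a ≠ 0 := fun h => hd (Nat.dvd_of_mod_eq_zero h)
  have hlt := Nat.mod_lt g ha
  have hdiv := Nat.mod_add_div g a
  have hm : a * (g / a + 1) = a * (g / a) + a := by ring
  have hset : {n ∈ Finset.Ioo g (g + a) | ¬ a ∣ n} =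
      (Finset.Ioo g (g + a)).erase (a * (g / a + 1)) := by
    ext n
    simp only [Finset.mem_filter, Finset.mem_erase, Finset.mem_Ioo]
    refine ⟨fun ⟨h1, h2⟩ => ⟨fun h => h2 (h ▸ dvd_mul_right _ _), h1⟩,
      fun ⟨h1, h2⟩ => ⟨h2, ?_⟩⟩
    rintro ⟨k, rfl⟩
    have hk1 : g / a < k := by
      by_contra! h
      have := Nat.mul_le_mul_left a h
      omega
    have hk2 : k < g / a + 2 := by
      by_contra! h
      have := Nat.mul_le_mul_left a h
      rw [show a * (g / a + 2) = a * (g / a) + a + a by ring] at this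
      omega
    exact h1 (by rw [show k = g / a + 1 by omega])
  rw [hset, Finset.card_erase_of_mem (Finset.mem_Ioo.2 ⟨by omega, by omega⟩), Nat.card_Ioo]
  omega

theorem stmt7 (S : Set ℕ) (hS : IsNumericalSemigroup S) (hrefl : Reflective S)
    (g a : ℕ) (hg : genus S = g) (hg1 : 1 ≤ g) (ha : mult S = a) :
    (¬ a ∣ (g + 1) → embdim S = a - 1) ∧
    (a ∣ (g + 1) → embdim S = a) := by
  classical
  subst hg ha
  have hmem := hrefl.mem_minGens_iff hS hg1
  have hdg := hrefl.not_mult_dvd_genus hS hg1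
  have hle := hrefl.mult_le_genus_add_one hS hg1
  have ha0 := hS.mult_spec.2.1
  have hcard := card_filter_not_dvd_Ioo ha0 hdg
  have ha1 : mult S ≠ 1 := fun h => hdg (h ▸ one_dvd _)
  have hnot : mult S ∉ {n ∈ Finset.Ioo (genus S) (genus S + mult S) | ¬ mult S ∣ n} := by
    simp
  constructor
  · intro hd
    have hset : minGens S = ↑(insert (mult S)
        {n ∈ Finset.Ioo (genus S) (genus S + mult S) | ¬ mult S ∣ n}) := by
      ext n
      simp [hmem, hd, and_assoc]
    rw [embdim, hset, Set.ncard_coe_finset, Finset.card_insert_of_notMem hnot, hcard]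
    omega
  · intro hd
    have hset : minGens S = ↑(insert (2 * genus S + 1) (insert (mult S)
        {n ∈ Finset.Ioo (genus S) (genus S + mult S) | ¬ mult S ∣ n})) := by
      ext n
      simp only [hmem, hd, and_true, Finset.coe_insert, Finset.coe_filter, Finset.mem_Ioo,
        Set.mem_insert_iff, Set.mem_ofPred_eq]
      tauto
    have hnot' : 2 * genus S + 1 ∉ insert (mult S)
        {n ∈ Finset.Ioo (genus S) (genus S + mult S) | ¬ mult S ∣ n} := by
      simp only [Finset.mem_insert, Finset.mem_filter, Finset.mem_Ioo]
      omega
    rw [embdim, hset, Set.ncard_coe_finset, Finset.card_insert_of_notMem hnot',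
      Finset.card_insert_of_notMem hnot, hcard]
    omega
end
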